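/- Let V(r₁,r₂,r₃) denote the minimal Coulomb energy of three unit point charges on concentric spheres of radii r₁,r₂,r₃, and define G(ε) = 3 ∫₀^{1/3} V(1+εx, 1+ε(2/3−x), 1+ε(2/3+x)) dx for ε > 0. Then, as ε → 0⁺, G(ε) = √3 · (1 − ε/2 + (7/27)ε²) + O(ε³); that is, there exist constants C, δ > 0 such that |G(ε) − √3(1 − ε/2 + (7/27)ε²)| ≤ C ε³ for all 0 < ε < δ. -/

import Mathlib

/-- `V(r₁,r₂,r₃)`: the minimal Coulomb energy of three unit point charges
confined to concentric spheres of radii `r₁, r₂, r₃` in `ℝ³`, i.e. the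
infimum of `Σ_{i<j} 1/‖x_i − x_j‖` over `x_i ∈ ℝ³` with `‖x_i‖ = r_i`. -/
noncomputable def V3 (r₁ r₂ r₃ : ℝ) : ℝ :=
  sInf {e : ℝ | ∃ x₁ x₂ x₃ : EuclideanSpace ℝ (Fin 3),
    ‖x₁‖ = r₁ ∧ ‖x₂‖ = r₂ ∧ ‖x₃‖ = r₃ ∧
    e = 1 / ‖x₁ - x₂‖ + 1 / ‖x₁ - x₃‖ + 1 / ‖x₂ - x₃‖}

/-- The SGS interaction energy `G(ε) = a·V_ee^SGS[ρ_{a,ε}]` for the thin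
spherical-shell density with `N = 3` electrons. -/
noncomputable def Gsgs (ε : ℝ) : ℝ :=
  3 * ∫ x in (0:ℝ)..(1/3),
    V3 (1 + ε * x) (1 + ε * (2/3 - x)) (1 + ε * (2/3 + x))

noncomputable def polyR0 (a b c : ℝ) : ℝ :=
    (14/1125) * c^3 + (2/375) * b * c^2 + (-31/375) * b^2 * c + (91/225) * b^3
     + (2/375) * a * c^2 + (166/375) * a * b * c + (917/375) * a * b^2 + (-31/375) * a^2 * c
     + (917/375) * a^2 * b + (91/225) * a^3

noncomputable def polyR1 (a b c : ℝ) : ℝ :=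
    (-8/5625) * c^4 + (32/5625) * b * c^3 + (16/625) * b^2 * c^2 + (808/5625) * b^3 * c
     + (43/4500) * b^4 + (32/5625) * a * c^3 + (-52/625) * a * b * c^2
     + (16/1875) * a * b^2 * c + (-3169/5625) * a * b^3 + (16/625) * a^2 * c^2
     + (16/1875) * a^2 * b * c + (-1181/750) * a^2 * b^2 + (808/5625) * a^3 * c
     + (-3169/5625) * a^3 * b + (43/4500) * a^4

noncomputable def polyR2 (a b c : ℝ) : ℝ :=
    (4/28125) * c^5 + (-8/9375) * b * c^4 + (-49/9375) * b^2 * c^3 + (-151/5625) * b^3 * c^2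
     + (-433/6250) * b^4 * c + (-2167/37500) * b^5 + (-8/9375) * a * c^4
     + (68/5625) * a * b * c^3 + (1/625) * a * b^2 * c^2 + (-409/9375) * a * b^3 * c
     + (-2833/22500) * a * b^4 + (-49/9375) * a^2 * c^3 + (1/625) * a^2 * b * c^2
     + (163/625) * a^2 * b^2 * c + (5839/18750) * a^2 * b^3 + (-151/5625) * a^3 * c^2
     + (-409/9375) * a^3 * b * c + (5839/18750) * a^3 * b^2 + (-433/6250) * a^4 * c
     + (-2833/22500) * a^4 * b + (-2167/37500) * a^5

noncomputable def polyR3 (a b c : ℝ) : ℝ :=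
    (-1/140625) * c^6 + (2/15625) * b * c^5 + (76/140625) * b^2 * c^4
     + (538/140625) * b^3 * c^3 + (6379/562500) * b^4 * c^2 + (697/31250) * b^5 * c
     + (10643/281250) * b^6 + (2/15625) * a * c^5 + (-176/140625) * a * b * c^4
     + (656/140625) * a * b^2 * c^3 + (1451/140625) * a * b^3 * c^2
     + (21191/281250) * a * b^4 * c + (10621/37500) * a * b^5 + (76/140625) * a^2 * c^4
     + (656/140625) * a^2 * b * c^3 + (-3589/93750) * a^2 * b^2 * c^2
     + (5564/140625) * a^2 * b^3 * c + (37219/56250) * a^2 * b^4 + (538/140625) * a^3 * c^3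
     + (1451/140625) * a^3 * b * c^2 + (5564/140625) * a^3 * b^2 * c
     + (69187/93750) * a^3 * b^3 + (6379/562500) * a^4 * c^2 + (21191/281250) * a^4 * b * c
     + (37219/56250) * a^4 * b^2 + (697/31250) * a^5 * c + (10621/37500) * a^5 * b
     + (10643/281250) * a^6

noncomputable def polyR4 (a b c : ℝ) : ℝ :=
    (-1/140625) * b * c^6 + (-2/140625) * b^2 * c^5 + (-34/140625) * b^3 * c^4
     + (-37/140625) * b^4 * c^3 + (-1321/562500) * b^5 * c^2 + (-116/140625) * b^6 * c
     + (-841/140625) * b^7 + (-1/140625) * a * c^6 + (16/140625) * a * b * c^5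
     + (-2/9375) * a * b^2 * c^4 + (319/140625) * a * b^3 * c^3
     + (-4097/562500) * a * b^4 * c^2 + (1729/281250) * a * b^5 * c + (-9541/140625) * a * b^6
     + (-2/140625) * a^2 * c^5 + (-2/9375) * a^2 * b * c^4 + (1172/140625) * a^2 * b^2 * c^3
     + (-1/3750) * a^2 * b^3 * c^2 + (9142/140625) * a^2 * b^4 * c + (-6923/28125) * a^2 * b^5
     + (-34/140625) * a^3 * c^4 + (319/140625) * a^3 * b * c^3 + (-1/3750) * a^3 * b^2 * c^2
     + (6281/46875) * a^3 * b^3 * c + (-19369/46875) * a^3 * b^4 + (-37/140625) * a^4 * c^3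
     + (-4097/562500) * a^4 * b * c^2 + (9142/140625) * a^4 * b^2 * c
     + (-19369/46875) * a^4 * b^3 + (-1321/562500) * a^5 * c^2 + (1729/281250) * a^5 * b * c
     + (-6923/28125) * a^5 * b^2 + (-116/140625) * a^6 * c + (-9541/140625) * a^6 * b
     + (-841/140625) * a^7

noncomputable def polyR5 (a b c : ℝ) : ℝ :=
    (-1/140625) * a * b * c^6 + (-2/140625) * a * b^2 * c^5 + (-28/140625) * a * b^3 * c^4
     + (-1/5625) * a * b^4 * c^3 + (-601/562500) * a * b^5 * c^2 + (58/140625) * a * b^6 * c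
     + (841/281250) * a * b^7 + (-2/140625) * a^2 * b * c^5 + (-88/140625) * a^2 * b^2 * c^4
     + (-37/46875) * a^2 * b^3 * c^3 + (-119/15625) * a^2 * b^4 * c^2
     + (46/28125) * a^2 * b^5 * c + (2494/140625) * a^2 * b^6 + (-28/140625) * a^3 * b * c^4
     + (-37/46875) * a^3 * b^2 * c^3 + (-1433/93750) * a^3 * b^3 * c^2
     + (32/15625) * a^3 * b^4 * c + (9919/281250) * a^3 * b^5 + (-1/5625) * a^4 * b * c^3
     + (-119/15625) * a^4 * b^2 * c^2 + (32/15625) * a^4 * b^3 * c + (4988/140625) * a^4 * b^4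
     + (-601/562500) * a^5 * b * c^2 + (46/28125) * a^5 * b^2 * c + (9919/281250) * a^5 * b^3
     + (58/140625) * a^6 * b * c + (2494/140625) * a^6 * b^2 + (841/281250) * a^7 * b

noncomputable def polyR (e a b c : ℝ) : ℝ :=
  e^0 * polyR0 a b c + e^1 * polyR1 a b c + e^2 * polyR2 a b c + e^3 * polyR3 a b c + e^4 * polyR4 a b c + e^5 * polyR5 a b c

noncomputable def polyM (e x : ℝ) : ℝ :=
    (-9568/30375) + (-1516/3375) * x + (-616/1125) * x^2 + (-793/1125) * x^3
     + (-29608/1366875) * e + (25256/455625) * e * x + (-40628/50625) * e * x^2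
     + (-21413/101250) * e * x^3 + (79189/540000) * e * x^4 + (1512544/20503125) * e^2
     + (4552/91125) * e^2 * x + (256396/253125) * e^2 * x^2 + (506389/759375) * e^2 * x^3
     + (35507/45000) * e^2 * x^4 + (289321/900000) * e^2 * x^5 + (-76034912/2767921875) * e^3
     + (-5932048/307546875) * e^3 * x + (-45287722/102515625) * e^3 * x^2
     + (-28962658/102515625) * e^3 * x^3 + (-82961171/91125000) * e^3 * x^4
     + (-18341353/60750000) * e^3 * x^5 + (-152373421/486000000) * e^3 * x^6
     + (109722368/24911296875) * e^4 + (4743808/1660753125) * e^4 * x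
     + (80879024/922640625) * e^4 * x^2 + (44060164/922640625) * e^4 * x^3
     + (95362501/307546875) * e^4 * x^4 + (3958868/34171875) * e^4 * x^5
     + (107720207/546750000) * e^4 * x^6 + (7266457/145800000) * e^4 * x^7
     + (-20108032/74733890625) * e^5 + (-1530368/8303765625) * e^5 * x
     + (-18124528/2767921875) * e^5 * x^2 + (-10642064/2767921875) * e^5 * x^3
     + (-10122209/307546875) * e^5 * x^4 + (-205708/11390625) * e^5 * x^5
     + (-48390151/1640250000) * e^5 * x^6 + (-948509/60750000) * e^5 * x^7
     + (-1042441/486000000) * e^5 * x^8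

noncomputable def qq (e a b c : ℝ) : ℝ :=
  1 - e * (7 * (a + b) + c) / 15 + e^2 * ((29/150) * a^2 + (43/75) * a * b + (1/75) * a * c
    + (29/150) * b^2 + (1/75) * b * c + (1/75) * c^2)

noncomputable def ll (e a : ℝ) : ℝ := 1 - e * a / 5

noncomputable def hh (e a b c : ℝ) : ℝ := 1 - e * (13 * a + b + c) / 30

noncomputable def TT (e a b c : ℝ) : ℝ :=
  ((1 + e * a)^2 + (1 + e * b)^2) * (ll e a * ll e b)
    - (1 + e * a) * (1 + e * b) * ((ll e c)^2 - (ll e a)^2 - (ll e b)^2)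

noncomputable def SS (e x : ℝ) : ℝ :=
  3 - e * (4/3 + x) + e^2 * (28/45 + (4/5) * x + (3/5) * x^2)

theorem polyR_eq (e a b c : ℝ) :
    TT e a b c * (qq e a b c)^2 = 3 * (ll e a * ll e b) + e^3 * polyR e a b c := by
  unfold TT qq ll polyR polyR0 polyR1 polyR2 polyR3 polyR4 polyR5; ring

theorem qq_sum (e x : ℝ) :
    qq e x (2/3 - x) (2/3 + x) + qq e x (2/3 + x) (2/3 - x) + qq e (2/3 - x) (2/3 + x) x
      = SS e x := by
  unfold qq SS; ring

theorem polyM_eq (e x h1 h2 h3 : ℝ) (e1 : h1 = hh e x (2/3 - x) (2/3 + x))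
    (e2 : h2 = hh e (2/3 - x) x (2/3 + x)) (e3 : h3 = hh e (2/3 + x) x (2/3 - x)) :
    3/2 * (h1 * h2 + h1 * h3 + h2 * h3) - 1/6 * ((h1^3 + h2^3 + h3^3) *
      (h1^3 * (1 + e * x)^2 + h2^3 * (1 + e * (2/3 - x))^2 + h3^3 * (1 + e * (2/3 + x))^2))
      = SS e x + e^3 * polyM e x := by
  subst e1 e2 e3
  unfold hh SS polyM; ring

theorem polyR_bdd : ∃ K : ℝ, 0 < K ∧ ∀ e a b c : ℝ, 0 ≤ e → e ≤ 1 → 0 ≤ a → a ≤ 1 →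
    0 ≤ b → b ≤ 1 → 0 ≤ c → c ≤ 1 → |polyR e a b c| ≤ K := by
  have hc : IsCompact (Set.Icc (0:ℝ) 1 ×ˢ Set.Icc (0:ℝ) 1 ×ˢ Set.Icc (0:ℝ) 1 ×ˢ Set.Icc (0:ℝ) 1) :=
    isCompact_Icc.prod (isCompact_Icc.prod (isCompact_Icc.prod isCompact_Icc))
  have hf : Continuous (fun p : ℝ × ℝ × ℝ × ℝ => polyR p.1 p.2.1 p.2.2.1 p.2.2.2) := by
    unfold polyR polyR0 polyR1 polyR2 polyR3 polyR4 polyR5; fun_prop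
  obtain ⟨K, hK⟩ := hc.exists_bound_of_continuousOn hf.continuousOn
  refine ⟨max K 1, by positivity, fun e a b c h1 h2 h3 h4 h5 h6 h7 h8 => ?_⟩
  exact (hK (e, a, b, c) ⟨⟨h1, h2⟩, ⟨h3, h4⟩, ⟨h5, h6⟩, ⟨h7, h8⟩⟩).trans (le_max_left _ _)

theorem polyM_bdd : ∃ K : ℝ, 0 < K ∧ ∀ e x : ℝ, 0 ≤ e → e ≤ 1 → 0 ≤ x → x ≤ 1 →
    |polyM e x| ≤ K := by
  have hc : IsCompact (Set.Icc (0:ℝ) 1 ×ˢ Set.Icc (0:ℝ) 1) :=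
    isCompact_Icc.prod isCompact_Icc
  have hf : Continuous (fun p : ℝ × ℝ => polyM p.1 p.2) := by
    unfold polyM; fun_prop
  obtain ⟨K, hK⟩ := hc.exists_bound_of_continuousOn hf.continuousOn
  refine ⟨max K 1, by positivity, fun e x h1 h2 h3 h4 => ?_⟩
  exact (hK (e, x) ⟨⟨h1, h2⟩, ⟨h3, h4⟩⟩).trans (le_max_left _ _)

theorem tangent_bound (d h : ℝ) (hd : 0 < d) (hh : 0 < h) :
    (Real.sqrt 3 / 3) * (3/2 * h - h^3 * d^2 / 6) ≤ 1 / d := by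
  have h3 : Real.sqrt 3 ^ 2 = 3 := Real.sq_sqrt (by norm_num)
  have hs : 0 < Real.sqrt 3 := Real.sqrt_pos.mpr (by norm_num)
  set s := Real.sqrt 3
  rw [le_div_iff₀ hd]
  obtain ⟨v, hv⟩ : ∃ v, v = d * s / 3 := ⟨_, rfl⟩
  have hv0 : 0 < v := by rw [hv]; positivity
  have hd' : d = s * v := by rw [hv]; linear_combination (-d/3) * h3
  have key : s / 3 * (3/2 * h - h^3 * d^2 / 6) * d = 3/2 * (h * v) - (h*v)^3 / 2 := by
    rw [hd']
    linear_combination (h * v / 2 - h^3*v^3/18 * (s^2 + 3)) * h3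
  rw [key]
  have : 0 < h * v := by positivity
  nlinarith [mul_nonneg (sq_nonneg (h * v - 1)) (by linarith : 0 ≤ h * v + 2)]

abbrev E3 := EuclideanSpace ℝ (Fin 3)

theorem lower_bound (x₁ x₂ x₃ : E3) (h1 h2 h3 : ℝ) (p1 : 0 < h1) (p2 : 0 < h2) (p3 : 0 < h3)
    (d12 : x₁ ≠ x₂) (d13 : x₁ ≠ x₃) (d23 : x₂ ≠ x₃) :
    (Real.sqrt 3 / 3) * (3/2 * (h1 * h2 + h1 * h3 + h2 * h3) - 1/6 * ((h1^3 + h2^3 + h3^3) *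
      (h1^3 * ‖x₁‖^2 + h2^3 * ‖x₂‖^2 + h3^3 * ‖x₃‖^2)))
    ≤ 1 / ‖x₁ - x₂‖ + 1 / ‖x₁ - x₃‖ + 1 / ‖x₂ - x₃‖ := by
  have t12 := tangent_bound ‖x₁ - x₂‖ (h1 * h2) (norm_pos_iff.mpr (sub_ne_zero.mpr d12))
    (by positivity)
  have t13 := tangent_bound ‖x₁ - x₃‖ (h1 * h3) (norm_pos_iff.mpr (sub_ne_zero.mpr d13))
    (by positivity)
  have t23 := tangent_bound ‖x₂ - x₃‖ (h2 * h3) (norm_pos_iff.mpr (sub_ne_zero.mpr d23))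
    (by positivity)
  have hs : 0 < Real.sqrt 3 := Real.sqrt_pos.mpr (by norm_num)
  have key : (h1*h2)^3 * ‖x₁ - x₂‖^2 + (h1*h3)^3 * ‖x₁ - x₃‖^2 + (h2*h3)^3 * ‖x₂ - x₃‖^2
      ≤ (h1^3 + h2^3 + h3^3) * (h1^3 * ‖x₁‖^2 + h2^3 * ‖x₂‖^2 + h3^3 * ‖x₃‖^2) := by
    have hn : 0 ≤ ‖h1^3 • x₁ + h2^3 • x₂ + h3^3 • x₃‖^2 := by positivity
    rw [norm_add_sq_real, norm_add_sq_real, inner_add_left] at hn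
    simp only [norm_smul, inner_smul_left, inner_smul_right, mul_pow, Real.norm_eq_abs, sq_abs,
      RCLike.conj_to_real] at hn
    rw [norm_sub_sq_real, norm_sub_sq_real, norm_sub_sq_real]
    nlinarith [hn]
  refine le_trans ?_ (add_le_add (add_le_add t12 t13) t23)
  have k2 := mul_le_mul_of_nonneg_left key (by positivity : 0 ≤ Real.sqrt 3 / 3 / 6)
  linarith

theorem config (l1 l2 l3 : ℝ) (p1 : 0 < l1) (p2 : 0 < l2) (p3 : 0 < l3)
    (t1 : l3 ≤ l1 + l2) (t2 : l1 ≤ l2 + l3) (t3 : l2 ≤ l1 + l3) :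
    ∃ u1 u2 u3 : E3, ‖u1‖ = 1 ∧ ‖u2‖ = 1 ∧ ‖u3‖ = 1 ∧
      2 * (l1 * l2) * inner ℝ u1 u2 = l3^2 - l1^2 - l2^2 ∧
      2 * (l1 * l3) * inner ℝ u1 u3 = l2^2 - l1^2 - l3^2 ∧
      2 * (l2 * l3) * inner ℝ u2 u3 = l1^2 - l2^2 - l3^2 := by
  obtain ⟨c, hc⟩ : ∃ c, c = (l3^2 - l1^2 - l2^2) / (2 * (l1 * l2)) := ⟨_, rfl⟩
  have hc' : 2 * (l1 * l2) * c = l3^2 - l1^2 - l2^2 := by rw [hc]; field_simp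
  have hc1 : c ≤ 1 := by
    rw [hc, div_le_one (by positivity)]; nlinarith
  have hc2 : -1 ≤ c := by
    rw [hc, le_div_iff₀ (by positivity)]
    nlinarith [mul_nonneg (by linarith : 0 ≤ l2 + l3 - l1) (by linarith : 0 ≤ l1 + l3 - l2)]
  obtain ⟨s, hs⟩ : ∃ s, s = Real.sqrt (1 - c^2) := ⟨_, rfl⟩
  have hs2 : s^2 = 1 - c^2 := by rw [hs]; exact Real.sq_sqrt (by nlinarith)
  let u1 : E3 := !₂[1, 0, 0]
  let u2 : E3 := !₂[c, s, 0]
  have n1 : ‖u1‖ = 1 := by simp [u1, EuclideanSpace.norm_eq, Fin.sum_univ_three]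
  have n2 : ‖u2‖ = 1 := by
    simp [u2, EuclideanSpace.norm_eq, Fin.sum_univ_three, hs2]
  have i12 : inner ℝ u1 u2 = c := by
    simp [u1, u2, PiLp.inner_apply, Fin.sum_univ_three]
  have i11 : inner ℝ u1 u1 = (1:ℝ) := by rw [real_inner_self_eq_norm_sq, n1]; norm_num
  have i22 : inner ℝ u2 u2 = (1:ℝ) := by rw [real_inner_self_eq_norm_sq, n2]; norm_num
  have i21 : inner ℝ u2 u1 = c := by rw [real_inner_comm, i12]
  refine ⟨u1, u2, (-l3⁻¹) • (l1 • u1 + l2 • u2), n1, n2, ?_, ?_, ?_, ?_⟩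
  · have hn : ‖l1 • u1 + l2 • u2‖ = l3 := by
      rw [← sq_eq_sq₀ (norm_nonneg _) p3.le, norm_add_sq_real]
      simp only [norm_smul, inner_smul_left, inner_smul_right, n1, n2, i12, mul_pow,
        Real.norm_eq_abs, sq_abs, RCLike.conj_to_real]
      linarith
    rw [norm_smul, hn, norm_neg, norm_inv, Real.norm_of_nonneg p3.le]
    field_simp
  · rw [i12, hc']
  · simp only [inner_add_right, inner_smul_right, i11, i12]
    field_simp
    linarith
  · simp only [inner_add_right, inner_smul_right, i22, i21]
    field_simp
    linarith

set_option maxHeartbeats 1000000 in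
theorem pair_upper (K : ℝ) (hK0 : 0 < K)
    (hK : ∀ e a b c : ℝ, 0 ≤ e → e ≤ 1 → 0 ≤ a → a ≤ 1 →
      0 ≤ b → b ≤ 1 → 0 ≤ c → c ≤ 1 → |polyR e a b c| ≤ K)
    (e a b c : ℝ) (e0 : 0 < e) (e1 : e ≤ 1/10) (a0 : 0 ≤ a) (a1 : a ≤ 1) (b0 : 0 ≤ b) (b1 : b ≤ 1)
    (c0 : 0 ≤ c) (c1 : c ≤ 1) (u v : E3) (hu : ‖u‖ = 1) (hv : ‖v‖ = 1)
    (huv : 2 * (ll e a * ll e b) * inner ℝ u v = (ll e c)^2 - (ll e a)^2 - (ll e b)^2) :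
    1 / ‖(1 + e * a) • u - (1 + e * b) • v‖ ≤ (Real.sqrt 3 / 3) * (qq e a b c + K * e^3) := by
  have hR := abs_le.mp (hK e a b c e0.le (by linarith) a0 a1 b0 b1 c0 c1)
  have hl : ∀ t : ℝ, 0 ≤ t → t ≤ 1 → 49/50 ≤ ll e t ∧ ll e t ≤ 1 := by
    intro t h0 h1
    unfold ll
    constructor <;> nlinarith
  obtain ⟨la0, la1⟩ := hl a a0 a1
  obtain ⟨lb0, lb1⟩ := hl b b0 b1
  obtain ⟨lc0, lc1⟩ := hl c c0 c1
  have ea : 0 ≤ e * a := by positivity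
  have eb : 0 ≤ e * b := by positivity
  have ec : e * c ≤ 1/10 := by nlinarith
  have ea' : e * a ≤ 1/10 := by nlinarith
  have eb' : e * b ≤ 1/10 := by nlinarith
  have hq : 1/2 ≤ qq e a b c := by
    unfold qq
    have : 0 ≤ e^2 * ((29/150) * a^2 + (43/75) * a * b + (1/75) * a * c
      + (29/150) * b^2 + (1/75) * b * c + (1/75) * c^2) := by positivity
    nlinarith
  have hll : 9/10 ≤ ll e a * ll e b := by nlinarith
  have hT : 1 ≤ TT e a b c := by
    unfold TT
    have h1 : 2 ≤ (1 + e * a)^2 + (1 + e * b)^2 := by nlinarith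
    have h2 : 0 ≤ (1 + e * a) * (1 + e * b) := by positivity
    have h3 : (ll e c)^2 - (ll e a)^2 - (ll e b)^2 ≤ 0 := by nlinarith
    nlinarith [mul_nonneg h2 (by linarith : 0 ≤ -((ll e c)^2 - (ll e a)^2 - (ll e b)^2))]
  have hd : ll e a * ll e b * ‖(1 + e * a) • u - (1 + e * b) • v‖^2 = TT e a b c := by
    rw [norm_sub_sq_real]
    simp only [norm_smul, inner_smul_left, inner_smul_right, hu, hv, mul_pow,
      Real.norm_eq_abs, sq_abs, RCLike.conj_to_real]
    unfold TT
    linear_combination (-(1 + e * a) * (1 + e * b)) * huv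
  have hP := polyR_eq e a b c
  set d := ‖(1 + e * a) • u - (1 + e * b) • v‖ with hdd
  have d0 : 0 ≤ d := norm_nonneg _
  have dpos : 0 < d := by
    rcases d0.lt_or_eq with h | h
    · exact h
    · rw [← h] at hd
      norm_num at hd
      linarith
  have e3 : 0 < e^3 := by positivity
  set Q := qq e a b c + K * e^3 with hQ
  have hQ0 : 0 < Q := by positivity
  have main : 3 * (ll e a * ll e b) ≤ TT e a b c * Q^2 := by
    have h1 : TT e a b c * Q^2 = 3 * (ll e a * ll e b)
        + e^3 * (polyR e a b c + 2 * TT e a b c * qq e a b c * K)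
        + TT e a b c * (K * e^3)^2 := by
      rw [hQ]; linear_combination hP
    have h2 : 1/2 ≤ TT e a b c * qq e a b c := by
      have := mul_le_mul hT hq (by norm_num) (by linarith)
      linarith
    have h3 : 0 ≤ polyR e a b c + 2 * TT e a b c * qq e a b c * K := by
      have := mul_le_mul_of_nonneg_right h2 hK0.le
      linarith [hR.1]
    have h4 : 0 ≤ TT e a b c * (K * e^3)^2 := by positivity
    have h5 := mul_nonneg e3.le h3
    linarith
  have m2 : 3 ≤ (d * Q)^2 := by
    rw [← hd] at main
    have : ll e a * ll e b * 3 ≤ ll e a * ll e b * (d * Q)^2 := by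
      rw [mul_pow]; linarith
    exact le_of_mul_le_mul_left this (by linarith)
  have m3 : Real.sqrt 3 ≤ d * Q := Real.sqrt_le_iff.mpr ⟨by positivity, m2⟩
  have h3 : Real.sqrt 3 * Real.sqrt 3 = 3 := Real.mul_self_sqrt (by norm_num)
  have hs : 0 < Real.sqrt 3 := Real.sqrt_pos.mpr (by norm_num)
  rw [div_le_iff₀ dpos]
  have := mul_le_mul_of_nonneg_left m3 hs.le
  linarith

theorem V3_bddBelow (r₁ r₂ r₃ : ℝ) : BddBelow {e : ℝ | ∃ x₁ x₂ x₃ : EuclideanSpace ℝ (Fin 3),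
    ‖x₁‖ = r₁ ∧ ‖x₂‖ = r₂ ∧ ‖x₃‖ = r₃ ∧
    e = 1 / ‖x₁ - x₂‖ + 1 / ‖x₁ - x₃‖ + 1 / ‖x₂ - x₃‖} := by
  refine ⟨0, ?_⟩
  rintro e ⟨x, y, z, -, -, -, rfl⟩
  positivity

theorem V3_le (x y z : E3) :
    V3 ‖x‖ ‖y‖ ‖z‖ ≤ 1 / ‖x - y‖ + 1 / ‖x - z‖ + 1 / ‖y - z‖ :=
  csInf_le (V3_bddBelow _ _ _) ⟨x, y, z, rfl, rfl, rfl, rfl⟩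

theorem V3_nonempty (r₁ r₂ r₃ : ℝ) (h1 : 0 ≤ r₁) (h2 : 0 ≤ r₂) (h3 : 0 ≤ r₃) :
    {e : ℝ | ∃ x₁ x₂ x₃ : EuclideanSpace ℝ (Fin 3),
    ‖x₁‖ = r₁ ∧ ‖x₂‖ = r₂ ∧ ‖x₃‖ = r₃ ∧
    e = 1 / ‖x₁ - x₂‖ + 1 / ‖x₁ - x₃‖ + 1 / ‖x₂ - x₃‖}.Nonempty := by
  obtain ⟨x, hx⟩ := exists_norm_eq E3 h1
  obtain ⟨y, hy⟩ := exists_norm_eq E3 h2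
  obtain ⟨z, hz⟩ := exists_norm_eq E3 h3
  exact ⟨_, x, y, z, hx, hy, hz, rfl⟩

theorem pointwise : ∃ K : ℝ, 0 < K ∧ ∀ e x : ℝ, 0 < e → e ≤ 1/10 → 0 < x → x < 1/3 →
    |V3 (1 + e * x) (1 + e * (2/3 - x)) (1 + e * (2/3 + x)) - Real.sqrt 3 / 3 * SS e x|
      ≤ K * e^3 := by
  obtain ⟨K, hK0, hK⟩ := polyR_bdd
  obtain ⟨M, hM0, hM⟩ := polyM_bdd
  have hs : 0 < Real.sqrt 3 := Real.sqrt_pos.mpr (by norm_num)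
  refine ⟨Real.sqrt 3 / 3 * (3 * K + M), by positivity, fun e x e0 e1 x0 x1 => ?_⟩
  have e3 : 0 < e^3 := by positivity
  have r1 : 0 < 1 + e * x := by nlinarith
  have r2 : 0 < 1 + e * (2/3 - x) := by nlinarith
  have r3 : 0 < 1 + e * (2/3 + x) := by nlinarith
  rw [abs_le]
  constructor
  · have hl : Real.sqrt 3 / 3 * (SS e x + e^3 * polyM e x)
        ≤ V3 (1 + e * x) (1 + e * (2/3 - x)) (1 + e * (2/3 + x)) := by
      apply le_csInf (V3_nonempty _ _ _ r1.le r2.le r3.le)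
      rintro E ⟨y1, y2, y3, n1, n2, n3, rfl⟩
      have := lower_bound y1 y2 y3 (hh e x (2/3 - x) (2/3 + x)) (hh e (2/3 - x) x (2/3 + x))
        (hh e (2/3 + x) x (2/3 - x)) (by unfold hh; nlinarith) (by unfold hh; nlinarith)
        (by unfold hh; nlinarith)
        (by rintro rfl; rw [n1] at n2; nlinarith) (by rintro rfl; rw [n1] at n3; nlinarith)
        (by rintro rfl; rw [n2] at n3; nlinarith)
      rw [n1, n2, n3, polyM_eq e x _ _ _ rfl rfl rfl] at this
      exact this
    have h1 := (abs_le.mp (hM e x e0.le (by linarith) x0.le (by linarith))).1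
    have h2 : 0 ≤ Real.sqrt 3 / 3 * (e^3 * (polyM e x + M)) := by
      have : 0 ≤ polyM e x + M := by linarith
      positivity
    have h4 : 0 ≤ Real.sqrt 3 / 3 * (3 * K * e^3) := by positivity
    linarith
  · have hl : ∀ t : ℝ, 0 ≤ t → t ≤ 1 → 49/50 ≤ ll e t ∧ ll e t ≤ 1 := by
      intro t h0 h1
      unfold ll
      constructor <;> nlinarith
    obtain ⟨la0, la1⟩ := hl x (by linarith) (by linarith)
    obtain ⟨lb0, lb1⟩ := hl (2/3 - x) (by linarith) (by linarith)
    obtain ⟨lc0, lc1⟩ := hl (2/3 + x) (by linarith) (by linarith)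
    obtain ⟨u1, u2, u3, n1, n2, n3, i12, i13, i23⟩ := config (ll e x) (ll e (2/3 - x))
      (ll e (2/3 + x)) (by linarith) (by linarith) (by linarith) (by linarith) (by linarith)
      (by linarith)
    have p12 := pair_upper K hK0 hK e x (2/3 - x) (2/3 + x) e0 e1 (by linarith) (by linarith)
      (by linarith) (by linarith) (by linarith) (by linarith) u1 u2 n1 n2 i12
    have p13 := pair_upper K hK0 hK e x (2/3 + x) (2/3 - x) e0 e1 (by linarith) (by linarith)
      (by linarith) (by linarith) (by linarith) (by linarith) u1 u3 n1 n3 i13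
    have p23 := pair_upper K hK0 hK e (2/3 - x) (2/3 + x) x e0 e1 (by linarith) (by linarith)
      (by linarith) (by linarith) (by linarith) (by linarith) u2 u3 n2 n3 i23
    have hv := V3_le ((1 + e * x) • u1) ((1 + e * (2/3 - x)) • u2) ((1 + e * (2/3 + x)) • u3)
    simp only [norm_smul, n1, n2, n3, mul_one, Real.norm_of_nonneg r1.le,
      Real.norm_of_nonneg r2.le, Real.norm_of_nonneg r3.le] at hv
    have hq := qq_sum e x
    have h4 : 0 ≤ Real.sqrt 3 / 3 * (M * e^3) := by positivity
    rw [← hq]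
    linarith

theorem meas (e : ℝ) (e0 : 0 < e) : AEMeasurable
    (fun x => V3 (1 + e * x) (1 + e * (2/3 - x)) (1 + e * (2/3 + x)))
    (MeasureTheory.volume.restrict (Set.Ioo (0:ℝ) (1/3))) := by
  apply aemeasurable_restrict_of_measurable_subtype measurableSet_Ioo
  apply UpperSemicontinuous.measurable
  rintro ⟨x, x0, x1⟩ y hy
  simp only at hy
  have r1 : 0 < 1 + e * x := by nlinarith
  have r2 : 0 < 1 + e * (2/3 - x) := by nlinarith
  have r3 : 0 < 1 + e * (2/3 + x) := by nlinarith
  obtain ⟨E, ⟨y1, y2, y3, n1, n2, n3, rfl⟩, hE⟩ :=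
    exists_lt_of_csInf_lt (V3_nonempty _ _ _ r1.le r2.le r3.le) hy
  have d12 : y1 ≠ y2 := by rintro rfl; rw [n1] at n2; nlinarith
  have d13 : y1 ≠ y3 := by rintro rfl; rw [n1] at n3; nlinarith
  have d23 : y2 ≠ y3 := by rintro rfl; rw [n2] at n3; nlinarith
  let z1 : Set.Ioo (0:ℝ) (1/3) → E3 := fun t => ((1 + e * t.1) / (1 + e * x)) • y1
  let z2 : Set.Ioo (0:ℝ) (1/3) → E3 := fun t => ((1 + e * (2/3 - t.1)) / (1 + e * (2/3 - x))) • y2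
  let z3 : Set.Ioo (0:ℝ) (1/3) → E3 := fun t => ((1 + e * (2/3 + t.1)) / (1 + e * (2/3 + x))) • y3
  have c1 : Continuous z1 := by simp only [z1, div_eq_mul_inv]; fun_prop
  have c2 : Continuous z2 := by simp only [z2, div_eq_mul_inv]; fun_prop
  have c3 : Continuous z3 := by simp only [z3, div_eq_mul_inv]; fun_prop
  have v1 : z1 ⟨x, x0, x1⟩ = y1 := by simp only [z1]; rw [div_self r1.ne', one_smul]
  have v2 : z2 ⟨x, x0, x1⟩ = y2 := by simp only [z2]; rw [div_self r2.ne', one_smul]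
  have v3 : z3 ⟨x, x0, x1⟩ = y3 := by simp only [z3]; rw [div_self r3.ne', one_smul]
  have hcont : ContinuousAt (fun t => 1 / ‖z1 t - z2 t‖ + 1 / ‖z1 t - z3 t‖ + 1 / ‖z2 t - z3 t‖)
      ⟨x, x0, x1⟩ := by
    refine ContinuousAt.add (ContinuousAt.add ?_ ?_) ?_
    · refine continuousAt_const.div (by fun_prop) ?_
      rw [v1, v2]; exact norm_ne_zero_iff.mpr (sub_ne_zero.mpr d12)
    · refine continuousAt_const.div (by fun_prop) ?_
      rw [v1, v3]; exact norm_ne_zero_iff.mpr (sub_ne_zero.mpr d13)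
    · refine continuousAt_const.div (by fun_prop) ?_
      rw [v2, v3]; exact norm_ne_zero_iff.mpr (sub_ne_zero.mpr d23)
  have hev := hcont.eventually_lt (continuousAt_const (y := y)) (by
    simp only [v1, v2, v3]; exact hE)
  filter_upwards [hev] with t ht
  refine lt_of_le_of_lt ?_ ht
  obtain ⟨t, t0, t1⟩ := t
  have s1 : 0 < 1 + e * t := by nlinarith
  have s2 : 0 < 1 + e * (2/3 - t) := by nlinarith
  have s3 : 0 < 1 + e * (2/3 + t) := by nlinarith
  have w1 : ‖z1 ⟨t, t0, t1⟩‖ = 1 + e * t := by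
    simp only [z1, norm_smul, n1, Real.norm_of_nonneg (div_pos s1 r1).le]
    field_simp
  have w2 : ‖z2 ⟨t, t0, t1⟩‖ = 1 + e * (2/3 - t) := by
    simp only [z2, norm_smul, n2, Real.norm_of_nonneg (div_pos s2 r2).le]
    exact div_mul_cancel₀ _ r2.ne'
  have w3 : ‖z3 ⟨t, t0, t1⟩‖ = 1 + e * (2/3 + t) := by
    simp only [z3, norm_smul, n3, Real.norm_of_nonneg (div_pos s3 r3).le]
    exact div_mul_cancel₀ _ r3.ne'
  have := V3_le (z1 ⟨t, t0, t1⟩) (z2 ⟨t, t0, t1⟩) (z3 ⟨t, t0, t1⟩)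
  rw [w1, w2, w3] at this
  exact this

theorem SS_integral (e : ℝ) : ∫ x in (0:ℝ)..(1/3), SS e x = 1 - e / 2 + (7/27) * e^2 := by
  have hd : ∀ x ∈ Set.uIcc (0:ℝ) (1/3), HasDerivAt
      (fun x => 3 * x - e * (4/3 * x + x^2/2) + e^2 * (28/45 * x + (2/5) * x^2 + (1/5) * x^3))
      (SS e x) x := by
    intro x _
    have h1 := hasDerivAt_id' x
    have h2 := hasDerivAt_pow 2 x
    have h3 := hasDerivAt_pow 3 x
    have := ((h1.const_mul 3).sub (((h1.const_mul (4/3)).add (h2.div_const 2)).const_mul e)).add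
      ((((h1.const_mul (28/45)).add (h2.const_mul (2/5))).add (h3.const_mul (1/5))).const_mul (e^2))
    refine this.congr_deriv ?_
    unfold SS
    push_cast
    ring
  rw [intervalIntegral.integral_eq_sub_of_hasDerivAt hd]
  · ring
  · apply Continuous.intervalIntegrable
    unfold SS; fun_prop

/-- **Small-`ε` expansion of the SGS interaction energy:**
`G(ε) = √3·(1 − ε/2 + (7/27)ε²) + O(ε³)` as `ε → 0⁺`. -/
theorem sgs_energy_expansion :
    ∃ C δ : ℝ, 0 < C ∧ 0 < δ ∧ ∀ ε : ℝ, 0 < ε → ε < δ →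
      |Gsgs ε - Real.sqrt 3 * (1 - ε / 2 + (7/27) * ε ^ 2)| ≤ C * ε ^ 3 := by
  obtain ⟨K, hK0, hK⟩ := pointwise
  refine ⟨K, 1/10, hK0, by norm_num, fun e e0 e1 => ?_⟩
  set f : ℝ → ℝ := fun x => V3 (1 + e * x) (1 + e * (2/3 - x)) (1 + e * (2/3 + x)) with hf
  have hSc : Continuous (fun x => Real.sqrt 3 / 3 * SS e x) := by unfold SS; fun_prop
  have hae : ∀ᵐ x ∂(MeasureTheory.volume.restrict (Set.Ioo (0:ℝ) (1/3))),
      ‖f x - Real.sqrt 3 / 3 * SS e x‖ ≤ K * e^3 := by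
    filter_upwards [MeasureTheory.ae_restrict_mem measurableSet_Ioo] with x hx
    exact hK e x e0 e1.le hx.1 hx.2
  have hgi : MeasureTheory.IntegrableOn (fun x => f x - Real.sqrt 3 / 3 * SS e x)
      (Set.Ioo (0:ℝ) (1/3)) := by
    refine MeasureTheory.Integrable.of_bound
      ((meas e e0).sub hSc.aemeasurable).aestronglyMeasurable (K * e^3) hae
  have hgi' : IntervalIntegrable (fun x => f x - Real.sqrt 3 / 3 * SS e x)
      MeasureTheory.volume 0 (1/3) := by
    rw [intervalIntegrable_iff_integrableOn_Ioo_of_le (by norm_num)]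
    exact hgi
  have hSi := hSc.intervalIntegrable (μ := MeasureTheory.volume) 0 (1/3)
  have hfint : ∫ x in (0:ℝ)..(1/3), f x = (∫ x in (0:ℝ)..(1/3), (f x - Real.sqrt 3 / 3 * SS e x))
      + Real.sqrt 3 / 3 * (1 - e / 2 + (7/27) * e^2) := by
    rw [← SS_integral, ← intervalIntegral.integral_const_mul,
      ← intervalIntegral.integral_add hgi' hSi]
    simp
  have hb : ‖∫ x in (0:ℝ)..(1/3), (f x - Real.sqrt 3 / 3 * SS e x)‖ ≤ K * e^3 * (1/3) := by
    rw [intervalIntegral.integral_of_le (by norm_num), MeasureTheory.integral_Ioc_eq_integral_Ioo]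
    refine (MeasureTheory.norm_integral_le_of_norm_le_const hae).trans ?_
    simp [MeasureTheory.measureReal_def]
  have : Gsgs e - Real.sqrt 3 * (1 - e / 2 + (7/27) * e ^ 2)
      = 3 * ∫ x in (0:ℝ)..(1/3), (f x - Real.sqrt 3 / 3 * SS e x) := by
    unfold Gsgs
    rw [hfint]; ring
  rw [this, abs_mul, abs_of_pos (by norm_num : (0:ℝ) < 3)]
  rw [Real.norm_eq_abs] at hb
  linarith
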